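/- arXiv:1312.4402 — 2 statements merged into one kernel-verified Lean document; each statement's English description precedes it below -/
import Mathlib

section
/- With b = 239/181440, define t_n = ln(n!) − ln(√(2π)) − (1/2)·ln(n + b/n⁴) − n·ln(n/e + 1/(12en) + 1/(1440en³)) for n ≥ 1. Then lim_{n→∞} n⁵·t_n = 0; in particular lim_{n→∞} n! / ( √(2π(n + 239/(181440·n⁴)))·(n/e + 1/(12en) + 1/(1440en³))ⁿ ) = 1. -/
open Filter Topology Real

/-- The first three terms of the Stirling series for `log n!`. -/
noncomputable def stirlingSeries (x : ℝ) : ℝ :=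
  1 / (12 * x) - 1 / (360 * x ^ 3) + 1 / (1260 * x ^ 5)

lemma le_of_sub_succ_le_sub_succ {a c : ℕ → ℝ} (ha : Tendsto a atTop (𝓝 0))
    (hc : Tendsto c atTop (𝓝 0)) (h : ∀ m, a m - a (m + 1) ≤ c m - c (m + 1)) (m : ℕ) :
    a m ≤ c m := by
  have hmono : Monotone fun m => a m - c m := monotone_nat_of_le_succ fun m => by linarith [h m]
  have hlim : Tendsto (fun m => a m - c m) atTop (𝓝 0) := by simpa using ha.sub hc
  linarith [hmono.ge_of_tendsto hlim m]

lemma stirlingSeries_sub_le {x : ℝ} (hx : 1 ≤ x) :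
    stirlingSeries x - 1 / x ^ 6 - (stirlingSeries (x + 1) - 1 / (x + 1) ^ 6) ≤
      (1 / (2 * x + 1)) ^ 2 / 3 + (1 / (2 * x + 1)) ^ 4 / 5 + (1 / (2 * x + 1)) ^ 6 / 7 := by
  obtain ⟨z, hz, rfl⟩ : ∃ z : ℝ, 0 ≤ z ∧ x = z + 1 := ⟨x - 1, by linarith, by ring⟩
  have h1 : z + 1 ≠ 0 := by positivity
  have h2 : z + 1 + 1 ≠ 0 := by positivity
  have h3 : 2 * (z + 1) + 1 ≠ 0 := by positivity
  unfold stirlingSeries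
  rw [← sub_nonneg]
  field_simp
  ring_nf
  positivity

lemma le_stirlingSeries_sub {x : ℝ} (hx : 1 ≤ x) :
    (1 / (2 * x + 1)) ^ 2 / 3 + (1 / (2 * x + 1)) ^ 4 / 5 + (1 / (2 * x + 1)) ^ 6 / 7 +
        (1 / (2 * x + 1)) ^ 6 / (4 * x * (x + 1)) ≤
      stirlingSeries x + 1 / x ^ 6 - (stirlingSeries (x + 1) + 1 / (x + 1) ^ 6) := by
  obtain ⟨z, hz, rfl⟩ : ∃ z : ℝ, 0 ≤ z ∧ x = z + 1 := ⟨x - 1, by linarith, by ring⟩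
  have h1 : z + 1 ≠ 0 := by positivity
  have h2 : z + 1 + 1 ≠ 0 := by positivity
  have h3 : 2 * (z + 1) + 1 ≠ 0 := by positivity
  unfold stirlingSeries
  rw [← sub_nonneg]
  field_simp
  ring_nf
  positivity

lemma tendsto_stirlingSeries : Tendsto stirlingSeries atTop (𝓝 0) := by
  have h (k : ℕ) (hk : k ≠ 0) (c : ℝ) : Tendsto (fun x : ℝ => 1 / (c * x ^ k)) atTop (𝓝 0) := by
    have := ((tendsto_pow_neg_atTop (𝕜 := ℝ) hk).const_mul c⁻¹)
    simpa [mul_comm] using this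
  have hsum := ((h 1 one_ne_zero 12).sub (h 3 (by simp) 360)).add (h 5 (by simp) 1260)
  simp only [pow_one, sub_zero, add_zero] at hsum
  exact hsum

lemma abs_log_stirlingSeq_sub_le {n : ℕ} (hn : 1 ≤ n) :
    |Real.log (Stirling.stirlingSeq n) - Real.log √π - stirlingSeries n| ≤ 1 / (n : ℝ) ^ 6 := by
  obtain ⟨m, rfl⟩ : ∃ m, n = m + 1 := ⟨n - 1, by omega⟩
  have hcast : Tendsto (fun m : ℕ => ((m + 1 : ℕ) : ℝ)) atTop atTop :=
    tendsto_natCast_atTop_atTop.comp (tendsto_add_atTop_nat 1)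
  have ha : Tendsto (fun m : ℕ => Real.log (Stirling.stirlingSeq (m + 1)) - Real.log √π)
      atTop (𝓝 0) := by
    have h := (Stirling.tendsto_stirlingSeq_sqrt_pi.comp (tendsto_add_atTop_nat 1)).log
      (by positivity)
    simpa using h.sub_const (Real.log √π)
  have hp : Tendsto (fun m : ℕ => stirlingSeries (m + 1 : ℕ)) atTop (𝓝 0) :=
    tendsto_stirlingSeries.comp hcast
  have hq : Tendsto (fun m : ℕ => 1 / ((m + 1 : ℕ) : ℝ) ^ 6) atTop (𝓝 0) := by
    simpa [Function.comp_def] using (tendsto_pow_neg_atTop (𝕜 := ℝ) (n := 6) (by simp)).comp hcast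
  have hlow (m : ℕ) := le_of_sub_succ_le_sub_succ
    (a := fun m => stirlingSeries (m + 1 : ℕ) - 1 / ((m + 1 : ℕ) : ℝ) ^ 6)
    (by simpa using hp.sub hq) ha (fun m => by
    have hx : (1 : ℝ) ≤ ((m + 1 : ℕ) : ℝ) := by exact_mod_cast Nat.le_add_left 1 m
    have hsum := Stirling.log_stirlingSeq_sdiff_hasSum m
    have hle := sum_le_hasSum (Finset.range 3) (fun k _ => by positivity) hsum
    have hb := stirlingSeries_sub_le hx
    simp only [Finset.sum_range_succ, Finset.sum_range_zero] at hle
    push_cast at hle hb ⊢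
    ring_nf at hle hb ⊢
    linarith) m
  have hupp (m : ℕ) := le_of_sub_succ_le_sub_succ ha
    (c := fun m => stirlingSeries (m + 1 : ℕ) + 1 / ((m + 1 : ℕ) : ℝ) ^ 6)
    (by simpa using hp.add hq) (fun m => by
    have hx : (1 : ℝ) ≤ ((m + 1 : ℕ) : ℝ) := by exact_mod_cast Nat.le_add_left 1 m
    have hsum := Stirling.log_stirlingSeq_sdiff_hasSum m
    have hb := le_stirlingSeries_sub hx
    rw [← hasSum_nat_add_iff' 3] at hsum
    set y : ℝ := 1 / (2 * ((m + 1 : ℕ) : ℝ) + 1) with hy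
    have hy0 : 0 ≤ y := by positivity
    have hy1 : y ^ 2 < 1 := by
      have : y < 1 := by rw [hy, div_lt_one (by positivity)]; linarith
      nlinarith
    have hgeo := (hasSum_geometric_of_lt_one (sq_nonneg y) hy1).mul_left (y ^ 8)
    have hle := hasSum_le (fun k => ?_) hsum hgeo
    · have htail : y ^ 8 * (1 - y ^ 2)⁻¹ =
          y ^ 6 / (4 * ((m + 1 : ℕ) : ℝ) * (((m + 1 : ℕ) : ℝ) + 1)) := by
        have : 1 - y ^ 2 = 4 * ((m + 1 : ℕ) : ℝ) * (((m + 1 : ℕ) : ℝ) + 1) * y ^ 2 := by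
          rw [hy]; field_simp; ring
        rw [this]
        have : y ≠ 0 := by positivity
        field_simp
      simp only [Finset.sum_range_succ, Finset.sum_range_zero] at hle
      rw [htail] at hle
      have h5 : y ^ 2 / 3 + y ^ 4 / 5 + y ^ 6 / 7 =
        0 + (1 : ℝ) / (2 * ((0 + 1 : ℕ) : ℝ) + 1) * (y ^ 2) ^ (0 + 1) +
         (1 : ℝ) / (2 * ((1 + 1 : ℕ) : ℝ) + 1) * (y ^ 2) ^ (1 + 1) +
         (1 : ℝ) / (2 * ((2 + 1 : ℕ) : ℝ) + 1) * (y ^ 2) ^ (2 + 1) := by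
        norm_num; ring
      push_cast at hle hb h5 ⊢
      linarith
    · rw [show y ^ 8 * (y ^ 2) ^ k = 1 * (y ^ 2) ^ (k + 3 + 1) by ring]
      gcongr
      rw [div_le_one (by positivity)]
      have : (0 : ℝ) ≤ ((k + 3 + 1 : ℕ) : ℝ) := by positivity
      linarith) m
  have h1 := hlow m
  have h2 := hupp m
  rw [abs_le]
  constructor <;> linarith

lemma abs_log_one_add_sub_le {u : ℝ} (h0 : 0 ≤ u) (h1 : u ≤ 1 / 2) :
    |Real.log (1 + u) - u| ≤ 2 * u ^ 2 := by
  have h := Real.abs_log_sub_add_sum_range_le (x := -u)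
    (by rw [abs_neg, abs_of_nonneg h0]; linarith) 1
  rw [abs_neg, abs_of_nonneg h0] at h
  simp only [Finset.sum_range_succ, Finset.sum_range_zero] at h
  norm_num at h
  rw [show Real.log (1 + u) - u = -u + Real.log (1 + u) by ring]
  refine h.trans ?_
  rw [div_le_iff₀ (by linarith)]
  nlinarith [sq_nonneg u]

lemma abs_log_one_add_sub_cubic_le {u : ℝ} (h0 : 0 ≤ u) (h1 : u ≤ 1 / 2) :
    |Real.log (1 + u) - (u - u ^ 2 / 2 + u ^ 3 / 3)| ≤ 2 * u ^ 4 := by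
  have h := Real.abs_log_sub_add_sum_range_le (x := -u)
    (by rw [abs_neg, abs_of_nonneg h0]; linarith) 3
  rw [abs_neg, abs_of_nonneg h0] at h
  simp only [Finset.sum_range_succ, Finset.sum_range_zero] at h
  norm_num at h
  rw [show Real.log (1 + u) - (u - u ^ 2 / 2 + u ^ 3 / 3) =
    -u + u ^ 2 / 2 + (-u) ^ 3 / 3 + Real.log (1 + u) by ring]
  refine h.trans ?_
  rw [div_le_iff₀ (by linarith)]
  nlinarith [pow_nonneg h0 4]

/-- The error of the approximation, as a function of the real variable `x`, after subtracting
the Stirling series. -/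
lemma abs_stirlingSeries_sub_le {x : ℝ} (hx : 1 ≤ x) :
    |stirlingSeries x - 1 / 2 * Real.log (1 + 239 / 181440 / x ^ 5)
      - x * Real.log (1 + (1 / (12 * x ^ 2) + 1 / (1440 * x ^ 4)))| ≤ 4 / x ^ 6 := by
  have hx0 : 0 < x := by linarith
  set v : ℝ := 239 / 181440 / x ^ 5 with hv
  set u : ℝ := 1 / (12 * x ^ 2) + 1 / (1440 * x ^ 4) with hu
  have hv0 : 0 ≤ v := by positivity
  have hu0 : 0 ≤ u := by positivity
  have hvx : v ≤ 1 / 2 / x ^ 5 := by rw [hv]; gcongr ?_ / _; norm_num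
  have hux : u ≤ 1 / 2 / x ^ 2 := by
    have : 1 / (1440 * x ^ 4) ≤ 1 / (1440 * x ^ 2) := by gcongr; norm_num
    calc u ≤ 1 / (12 * x ^ 2) + 1 / (1440 * x ^ 2) := by rw [hu]; linarith
      _ = (121 / 1440) / x ^ 2 := by field_simp; norm_num
      _ ≤ _ := by gcongr ?_ / _; norm_num
  have hv1 : v ≤ 1 / 2 := hvx.trans (div_le_self (by norm_num) (one_le_pow₀ hx))
  have hu1 : u ≤ 1 / 2 := hux.trans (div_le_self (by norm_num) (one_le_pow₀ hx))
  have h1 := abs_log_one_add_sub_le hv0 hv1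
  have h2 := abs_log_one_add_sub_cubic_le hu0 hu1
  have h1' : 2 * v ^ 2 ≤ 1 / x ^ 6 := by
    calc 2 * v ^ 2 ≤ 2 * (1 / 2 / x ^ 5) ^ 2 := by gcongr
      _ = 1 / 2 / x ^ 10 := by ring
      _ ≤ 1 / x ^ 6 := by gcongr <;> norm_num [hx]
  have h2' : x * (2 * u ^ 4) ≤ 1 / x ^ 6 := by
    calc x * (2 * u ^ 4) ≤ x * (2 * (1 / 2 / x ^ 2) ^ 4) := by gcongr
      _ = 1 / 8 / x ^ 7 := by field_simp; norm_num
      _ ≤ 1 / x ^ 6 := by gcongr <;> norm_num [hx]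
  have h3 : |stirlingSeries x - 1 / 2 * v - x * (u - u ^ 2 / 2 + u ^ 3 / 3)| ≤ 1 / x ^ 6 := by
    obtain ⟨z, hz, rfl⟩ : ∃ z : ℝ, 0 ≤ z ∧ x = z + 1 := ⟨x - 1, by linarith, by ring⟩
    rw [abs_le, hu, hv, stirlingSeries]
    constructor
    · rw [← sub_nonneg]
      field_simp
      ring_nf
      positivity
    · rw [← sub_nonneg]
      field_simp
      ring_nf
      positivity
  have h4 : |x * Real.log (1 + u) - x * (u - u ^ 2 / 2 + u ^ 3 / 3)| ≤ 1 / x ^ 6 := by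
    rw [← mul_sub, abs_mul, abs_of_pos hx0]
    exact (mul_le_mul_of_nonneg_left h2 hx0.le).trans h2'
  have h5 := h1.trans h1'
  have h6 : 4 / x ^ 6 = 4 * (1 / x ^ 6) := by ring
  rw [h6]
  rw [abs_le] at *
  constructor <;> linarith [h3.1, h3.2, h4.1, h4.2, h5.1, h5.2, (by positivity : 0 ≤ 1 / x ^ 6)]

lemma log_div_exp_add {x : ℝ} (hx : 0 < x) :
    Real.log (x / Real.exp 1 + 1 / (12 * Real.exp 1 * x) + 1 / (1440 * Real.exp 1 * x ^ 3)) =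
      Real.log (x / Real.exp 1) + Real.log (1 + (1 / (12 * x ^ 2) + 1 / (1440 * x ^ 4))) := by
  rw [← Real.log_mul (by positivity) (by positivity)]
  congr 1
  field_simp
  ring

lemma log_add_div_pow_four {x b : ℝ} (hx : 0 < x) (hb : 0 ≤ b) :
    Real.log (x + b / x ^ 4) = Real.log x + Real.log (1 + b / x ^ 5) := by
  rw [← Real.log_mul (by positivity) (by positivity)]
  congr 1
  field_simp

/-- Formula (5): with `b = 239/181440`, the error `t n` satisfies
`n⁵ * t n → 0`; in particular
`n! ∼ √(2π(n + 239/(181440 n⁴))) (n/e + 1/(12en) + 1/(1440en³))ⁿ`. -/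
theorem tendsto_pow_five_mul_t_best
    (t : ℕ → ℝ)
    (ht : ∀ n : ℕ, 1 ≤ n →
      t n = Real.log (Nat.factorial n) - Real.log (Real.sqrt (2 * π))
        - (1 / 2) * Real.log ((n : ℝ) + (239 / 181440 : ℝ) / (n : ℝ) ^ 4)
        - n * Real.log ((n : ℝ) / Real.exp 1 + 1 / (12 * Real.exp 1 * n)
            + 1 / (1440 * Real.exp 1 * (n : ℝ) ^ 3))) :
    Tendsto (fun n : ℕ => (n : ℝ) ^ 5 * t n) atTop (𝓝 0) ∧
      Tendsto (fun n : ℕ =>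
        (Nat.factorial n : ℝ) /
          (Real.sqrt (2 * π * ((n : ℝ) + 239 / (181440 * (n : ℝ) ^ 4))) *
            ((n : ℝ) / Real.exp 1 + 1 / (12 * Real.exp 1 * n)
              + 1 / (1440 * Real.exp 1 * (n : ℝ) ^ 3)) ^ n)) atTop (𝓝 1) := by
  have hbound (n : ℕ) (hn : 1 ≤ n) : |t n| ≤ 5 / (n : ℝ) ^ 6 := by
    have hx : (1 : ℝ) ≤ n := by exact_mod_cast hn
    have hx0 : (0 : ℝ) < n := by linarith
    have h1 := abs_log_stirlingSeq_sub_le hn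
    have h2 := abs_stirlingSeries_sub_le hx
    have hsqrt : Real.log √(2 * π) = Real.log √π + 1 / 2 * Real.log 2 := by
      rw [Real.log_sqrt (by positivity), Real.log_sqrt (by positivity),
        Real.log_mul (by norm_num) (by positivity)]
      ring
    have heq : t n = (Real.log (Stirling.stirlingSeq n) - Real.log √π - stirlingSeries n) +
        (stirlingSeries n - 1 / 2 * Real.log (1 + 239 / 181440 / (n : ℝ) ^ 5)
          - n * Real.log (1 + (1 / (12 * (n : ℝ) ^ 2) + 1 / (1440 * (n : ℝ) ^ 4)))) := by
      rw [ht n hn, Stirling.log_stirlingSeq_formula, log_div_exp_add hx0,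
        log_add_div_pow_four hx0 (by norm_num), hsqrt, Real.log_mul (by norm_num) hx0.ne']
      ring
    calc |t n| ≤ 1 / (n : ℝ) ^ 6 + 4 / (n : ℝ) ^ 6 := by
          rw [heq]; exact (abs_add_le _ _).trans (add_le_add h1 h2)
      _ = 5 / (n : ℝ) ^ 6 := by ring
  have hinv : Tendsto (fun n : ℕ => 5 / (n : ℝ)) atTop (𝓝 0) :=
    tendsto_const_div_atTop_nhds_zero_nat 5
  have ht0 : Tendsto t atTop (𝓝 0) := by
    refine squeeze_zero_norm' ?_ hinv
    filter_upwards [eventually_ge_atTop 1] with n hn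
    have hx : (1 : ℝ) ≤ n := by exact_mod_cast hn
    refine (hbound n hn).trans ?_
    gcongr
    exact le_self_pow₀ hx (by norm_num)
  refine ⟨squeeze_zero_norm' ?_ hinv, ?_⟩
  · filter_upwards [eventually_ge_atTop 1] with n hn
    have hx0 : (0 : ℝ) < n := by exact_mod_cast hn
    rw [Real.norm_eq_abs, abs_mul, abs_of_nonneg (by positivity : (0 : ℝ) ≤ (n : ℝ) ^ 5)]
    calc (n : ℝ) ^ 5 * |t n| ≤ (n : ℝ) ^ 5 * (5 / (n : ℝ) ^ 6) := by gcongr; exact hbound n hn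
      _ = 5 / (n : ℝ) := by field_simp
  · have hexp : Tendsto (fun n => Real.exp (t n)) atTop (𝓝 1) := by
      simpa using ht0.rexp
    refine hexp.congr' ?_
    filter_upwards [eventually_ge_atTop 1] with n hn
    have hx0 : (0 : ℝ) < n := by exact_mod_cast hn
    have hfac : (0 : ℝ) < n.factorial := by exact_mod_cast n.factorial_pos
    rw [← Real.exp_log (show 0 < (n.factorial : ℝ) /
      (√(2 * π * ((n : ℝ) + 239 / (181440 * (n : ℝ) ^ 4))) *
        ((n : ℝ) / Real.exp 1 + 1 / (12 * Real.exp 1 * n)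
          + 1 / (1440 * Real.exp 1 * (n : ℝ) ^ 3)) ^ n) by positivity)]
    rw [ht n hn, Real.log_div (by positivity) (by positivity),
      Real.log_mul (by positivity) (by positivity), Real.log_pow,
      Real.sqrt_mul (x := 2 * π) (by positivity), Real.log_mul (by positivity) (by positivity),
      Real.log_sqrt (x := (n : ℝ) + 239 / (181440 * (n : ℝ) ^ 4)) (by positivity), div_div]
    ring_nf
end

section
/- Mortici's approximation n! ≈ √(2πn)·(n/e + 1/(12en))ⁿ is asymptotically correct, i.e., lim_{n→∞} n! / ( √(2πn)·(n/e + 1/(12en))ⁿ ) = 1; moreover, with u_n = ln(n!) − ln(√(2π)) − (1/2)·ln n − n·ln(n/e + 1/(12en)), the rate of convergence of (u_n) to zero is n^{−3}, i.e., lim_{n→∞} n³·u_n = 1/1440. -/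
open Filter Topology Real

/-- A null sequence whose increments are dominated by those of a null sequence `g` is
dominated by `g`. -/
lemma abs_le_of_abs_sub_succ_le {a g : ℕ → ℝ} (ha : Tendsto a atTop (𝓝 0))
    (hg : Tendsto g atTop (𝓝 0)) (h : ∀ n, |a n - a (n + 1)| ≤ g n - g (n + 1)) (n : ℕ) :
    |a n| ≤ g n := by
  have hsub : Antitone (fun n => g n - a n) := antitone_nat_of_succ_le fun n => by
    linarith [(abs_le.mp (h n)).2]
  have hadd : Antitone (fun n => g n + a n) := antitone_nat_of_succ_le fun n => by
    linarith [(abs_le.mp (h n)).1]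
  have h1 := hsub.le_of_tendsto (by simpa using hg.sub ha) n
  have h2 := hadd.le_of_tendsto (by simpa using hg.add ha) n
  exact abs_le.mpr ⟨by linarith, by linarith⟩

/-- Two-sided bound for the decrements of `log ∘ stirlingSeq`, from its series expansion. -/
lemma log_stirlingSeq_sdiff_bounds (m : ℕ) {t : ℝ}
    (ht : t = ((m : ℝ) + 1) * ((m : ℝ) + 2)) :
    1 / (3 * (4 * t + 1)) + 1 / (5 * (4 * t + 1) ^ 2) ≤
        log (Stirling.stirlingSeq (m + 1)) - log (Stirling.stirlingSeq (m + 2)) ∧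
      log (Stirling.stirlingSeq (m + 1)) - log (Stirling.stirlingSeq (m + 2)) ≤
        1 / (3 * (4 * t + 1)) + 1 / (5 * (4 * t + 1) ^ 2) + 1 / (4 * t * (4 * t + 1) ^ 2) := by
  have htpos : 0 < t := by rw [ht]; positivity
  have hy : (1 / (2 * ((m + 1 : ℕ) : ℝ) + 1)) ^ 2 = 1 / (4 * t + 1) := by
    rw [ht, div_pow, one_pow]
    push_cast
    ring_nf
  have hs := Stirling.log_stirlingSeq_sdiff_hasSum m
  simp only [hy] at hs
  have hy0 : 0 ≤ 1 / (4 * t + 1) := by positivity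
  have hy1 : 1 / (4 * t + 1) < 1 := by
    rw [div_lt_one (by positivity)]
    linarith
  have htail := (hasSum_nat_add_iff' 2).mpr hs
  have hgeo := (hasSum_geometric_of_lt_one hy0 hy1).mul_left ((1 / (4 * t + 1)) ^ 3)
  have hlow := htail.nonneg fun k => by positivity
  have hupp := hasSum_le (fun k => by
    rw [← pow_add, show k + 2 + 1 = 3 + k by ring]
    refine mul_le_of_le_one_left (by positivity) ?_
    rw [div_le_one (by positivity)]
    push_cast
    linarith [(Nat.cast_nonneg k : (0 : ℝ) ≤ k)]) htail hgeo
  have hhead : ∑ i ∈ Finset.range 2, 1 / (2 * ((i + 1 : ℕ) : ℝ) + 1) * (1 / (4 * t + 1)) ^ (i + 1)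
      = 1 / (3 * (4 * t + 1)) + 1 / (5 * (4 * t + 1) ^ 2) := by
    simp only [Finset.sum_range_succ, Finset.sum_range_zero]
    norm_num
    field_simp
  have hrest : (1 / (4 * t + 1)) ^ 3 * (1 - 1 / (4 * t + 1))⁻¹ = 1 / (4 * t * (4 * t + 1) ^ 2) := by
    have : 1 - 1 / (4 * t + 1) = 4 * t / (4 * t + 1) := by field_simp; ring
    rw [this]
    field_simp
  rw [hhead] at hlow hupp
  rw [hrest] at hupp
  exact ⟨by linarith, by linarith⟩

/-- Stirling's expansion of `log n!` to third order, with explicit error. -/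
lemma abs_log_stirlingSeq_sub_le_s12 (m : ℕ) :
    |log (Stirling.stirlingSeq (m + 1)) - log (√π) - 1 / (12 * ((m : ℝ) + 1))
      + 1 / (360 * ((m : ℝ) + 1) ^ 3)| ≤ 1 / ((m : ℝ) + 1) ^ 5 := by
  have hinv : Tendsto (fun m : ℕ => 1 / ((m : ℝ) + 1)) atTop (𝓝 0) :=
    tendsto_one_div_add_atTop_nhds_zero_nat
  have hlog : Tendsto (fun m : ℕ => log (Stirling.stirlingSeq (m + 1))) atTop (𝓝 (log (√π))) :=
    ((tendsto_add_atTop_iff_nat 1).mpr Stirling.tendsto_stirlingSeq_sqrt_pi).log (by positivity)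
  refine abs_le_of_abs_sub_succ_le
    (a := fun m : ℕ => log (Stirling.stirlingSeq (m + 1)) - log (√π) - 1 / (12 * ((m : ℝ) + 1))
      + 1 / (360 * ((m : ℝ) + 1) ^ 3)) (g := fun m : ℕ => 1 / ((m : ℝ) + 1) ^ 5) ?_ ?_ ?_ m
  · have := ((hlog.sub_const (log (√π))).sub (hinv.const_mul (1 / 12))).add
      ((hinv.pow 3).const_mul (1 / 360))
    simp only [sub_self, mul_zero, ne_eq, OfNat.ofNat_ne_zero, not_false_eq_true, zero_pow,
      add_zero] at this
    refine this.congr fun m => ?_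
    field_simp
  · simpa using hinv.pow 5
  · intro n
    obtain ⟨hl, hu⟩ := log_stirlingSeq_sdiff_bounds n rfl
    set x : ℝ := (n : ℝ) + 1 with hx
    have hx0 : 0 < x := by positivity
    rw [show (n : ℝ) + 2 = x + 1 by rw [hx]; ring] at hl hu
    rw [show ((n + 1 : ℕ) : ℝ) + 1 = x + 1 by rw [hx]; push_cast; ring]
    have h1 : 1 / (12 * x) - 1 / (12 * (x + 1)) = 1 / (12 * (x * (x + 1))) := by
      field_simp; ring
    have h3 : 1 / (360 * x ^ 3) - 1 / (360 * (x + 1) ^ 3)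
        = (3 * (x * (x + 1)) + 1) / (360 * (x * (x + 1)) ^ 3) := by
      field_simp; ring
    have h5 : 1 / x ^ 5 - 1 / (x + 1) ^ 5
        = (5 * (x * (x + 1)) ^ 2 + 5 * (x * (x + 1)) + 1) / (x * (x + 1)) ^ 5 := by
      field_simp; ring
    rw [h5]
    have ht0 : 0 < x * (x + 1) := by positivity
    generalize x * (x + 1) = t at *
    have hL : 0 ≤ 1 / (3 * (4 * t + 1)) + 1 / (5 * (4 * t + 1) ^ 2) - 1 / (12 * t)
        + (3 * t + 1) / (360 * t ^ 3) + (5 * t ^ 2 + 5 * t + 1) / t ^ 5 := by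
      field_simp
      ring_nf
      positivity
    have hU : 0 ≤ (5 * t ^ 2 + 5 * t + 1) / t ^ 5 - (1 / (3 * (4 * t + 1))
        + 1 / (5 * (4 * t + 1) ^ 2) + 1 / (4 * t * (4 * t + 1) ^ 2) - 1 / (12 * t)
        + (3 * t + 1) / (360 * t ^ 3)) := by
      field_simp
      ring_nf
      positivity
    rw [show n + 1 + 1 = n + 2 from rfl]
    exact abs_le.mpr ⟨by linarith, by linarith⟩

/-- Second-order expansion of `log (1 + z)` at `z = 1 / (12 x ^ 2)`, with explicit error. -/
lemma abs_log_one_add_sub_le_s12 {x : ℝ} (hx : 1 ≤ x) :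
    |log (1 + 1 / (12 * x ^ 2)) - 1 / (12 * x ^ 2) + 1 / (288 * x ^ 4)| ≤ 1 / x ^ 6 := by
  have hx2 : 1 ≤ x ^ 2 := one_le_pow₀ hx
  have hz0 : 0 < 1 / (12 * x ^ 2) := by positivity
  have hz1 : 1 / (12 * x ^ 2) ≤ 1 / 12 := by
    apply one_div_le_one_div_of_le <;> linarith
  have habs : |-(1 / (12 * x ^ 2))| = 1 / (12 * x ^ 2) := by rw [abs_neg, abs_of_pos hz0]
  have h := abs_log_sub_add_sum_range_le (x := -(1 / (12 * x ^ 2))) (by rw [habs]; linarith) 2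
  rw [habs] at h
  have heq : log (1 + 1 / (12 * x ^ 2)) - 1 / (12 * x ^ 2) + 1 / (288 * x ^ 4)
      = ∑ i ∈ Finset.range 2, (-(1 / (12 * x ^ 2))) ^ (i + 1) / ((i : ℝ) + 1)
        + log (1 - -(1 / (12 * x ^ 2))) := by
    simp only [Finset.sum_range_succ, Finset.sum_range_zero, sub_neg_eq_add]
    norm_num
    field_simp
    ring
  rw [heq]
  refine h.trans ?_
  rw [div_le_iff₀ (by linarith)]
  calc (1 / (12 * x ^ 2)) ^ (2 + 1) = 1 / x ^ 6 * (1 / 1728) := by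
        rw [div_pow, mul_pow, ← pow_mul]
        norm_num
    _ ≤ 1 / x ^ 6 * (1 - 1 / (12 * x ^ 2)) := by gcongr; linarith

lemma log_mortici_base {x : ℝ} (hx : 0 < x) :
    log (x / exp 1 + 1 / (12 * exp 1 * x)) = log (x / exp 1) + log (1 + 1 / (12 * x ^ 2)) := by
  rw [← log_mul (by positivity) (by positivity)]
  congr 1
  field_simp

/-- Mortici's formula (1): `n! ∼ √(2πn) (n/e + 1/(12en))ⁿ`, and its
logarithmic error `u n` satisfies `n³ * u n → 1/1440`, i.e., the rate of
convergence of `u n` to zero is `n⁻³`. -/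
theorem mortici_formula
    (u : ℕ → ℝ)
    (hu : ∀ n : ℕ, 1 ≤ n →
      u n = Real.log (Nat.factorial n) - Real.log (Real.sqrt (2 * π))
        - (1 / 2) * Real.log n
        - n * Real.log ((n : ℝ) / Real.exp 1 + 1 / (12 * Real.exp 1 * n))) :
    Tendsto (fun n : ℕ =>
      (Nat.factorial n : ℝ) /
        (Real.sqrt (2 * π * n) *
          ((n : ℝ) / Real.exp 1 + 1 / (12 * Real.exp 1 * n)) ^ n)) atTop (𝓝 1) ∧
      Tendsto (fun n : ℕ => (n : ℝ) ^ 3 * u n) atTop (𝓝 (1 / 1440)) := by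
  have hbound : ∀ n : ℕ, 1 ≤ n → |(n : ℝ) ^ 3 * u n - 1 / 1440| ≤ 2 * (1 / (n : ℝ)) ^ 2 := by
    intro n hn
    have hx1 : (1 : ℝ) ≤ n := by exact_mod_cast hn
    have hx0 : (0 : ℝ) < n := by linarith
    have hS := abs_log_stirlingSeq_sub_le_s12 (n - 1)
    rw [Nat.sub_add_cancel hn, show ((n - 1 : ℕ) : ℝ) + 1 = n by
      rw [Nat.cast_sub hn]; simp, Stirling.log_stirlingSeq_formula] at hS
    have hL := abs_log_one_add_sub_le_s12 hx1
    rw [hu n hn, log_mortici_base hx0]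
    rw [log_mul two_ne_zero hx0.ne', log_sqrt pi_pos.le] at hS
    rw [log_sqrt (by positivity), log_mul two_ne_zero pi_ne_zero]
    generalize log (1 + 1 / (12 * (n : ℝ) ^ 2)) = l at *
    have hdecomp : (n : ℝ) ^ 3 * (log (n.factorial) - (log 2 + log π) / 2 - 1 / 2 * log n
          - n * (log (n / exp 1) + l)) - 1 / 1440
        = (n : ℝ) ^ 3 * (log (n.factorial) - 1 / 2 * (log 2 + log n) - n * log (n / exp 1)
            - log π / 2 - 1 / (12 * (n : ℝ)) + 1 / (360 * (n : ℝ) ^ 3))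
          - (n : ℝ) ^ 4 * (l - 1 / (12 * (n : ℝ) ^ 2) + 1 / (288 * (n : ℝ) ^ 4)) := by
      field_simp
      ring
    rw [hdecomp]
    refine (abs_sub _ _).trans ?_
    rw [abs_mul, abs_mul, abs_of_pos (pow_pos hx0 3), abs_of_pos (pow_pos hx0 4)]
    calc _ ≤ (n : ℝ) ^ 3 * (1 / (n : ℝ) ^ 5) + (n : ℝ) ^ 4 * (1 / (n : ℝ) ^ 6) := by gcongr
      _ = 2 * (1 / (n : ℝ)) ^ 2 := by field_simp; norm_num
  have hinv : Tendsto (fun n : ℕ => 1 / (n : ℝ)) atTop (𝓝 0) := tendsto_one_div_atTop_nhds_zero_nat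
  have hrate : Tendsto (fun n : ℕ => (n : ℝ) ^ 3 * u n) atTop (𝓝 (1 / 1440)) := by
    rw [tendsto_iff_norm_sub_tendsto_zero]
    refine squeeze_zero' (Eventually.of_forall fun _ => norm_nonneg _)
      ((eventually_ge_atTop 1).mono hbound) ?_
    simpa using (hinv.pow 2).const_mul 2
  refine ⟨?_, hrate⟩
  have hu0 : Tendsto u atTop (𝓝 0) := by
    have := (hinv.pow 3).mul hrate
    simp only [ne_eq, OfNat.ofNat_ne_zero, not_false_eq_true, zero_pow, zero_mul] at this
    refine this.congr' ((eventually_ge_atTop 1).mono fun n hn => ?_)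
    have hx0 : (0 : ℝ) < n := by exact_mod_cast hn
    field_simp
  have hexp := (continuous_exp.tendsto 0).comp hu0
  rw [exp_zero] at hexp
  refine hexp.congr' ((eventually_ge_atTop 1).mono fun n hn => ?_)
  have hx0 : (0 : ℝ) < n := by exact_mod_cast hn
  have hf : (0 : ℝ) < n.factorial := by exact_mod_cast n.factorial_pos
  beta_reduce
  rw [Function.comp_apply, ← exp_log (show 0 < (n.factorial : ℝ) / (√(2 * π * n) *
    (n / exp 1 + 1 / (12 * exp 1 * n)) ^ n) by positivity), hu n hn,
    log_div hf.ne' (by positivity), log_mul (by positivity) (by positivity), log_pow,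
    sqrt_mul (show 0 ≤ 2 * π by positivity) n, log_mul (x := √(2 * π)) (by positivity)
      (by positivity), log_sqrt hx0.le]
  congr 1
  ring
end
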